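/- There is a constant C > 0, depending only on the dimension n, with the following property: for every ball B = B(x₀, r) in ℝ^n with center x₀ and radius r satisfying 0 < r ≤ min(1, |x₀|/2), there exists a locally integrable function G : ℝ^n → ℝ such that (1) G is almost everywhere equal to a constant on B, (2) G(x) ≥ C^{-1} (log(e+|x₀|) + log(1/r)) for almost every x ∈ B, and (3) ‖G‖_{BMO⁺} ≤ C. -/

import Mathlib

open MeasureTheory Metric Real Filter
open scoped ENNReal Topology BigOperators

noncomputable section

/-- `ℝⁿ` with the Euclidean structure. -/
abbrev Eucl (n : ℕ) := EuclideanSpace ℝ (Fin n)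

/-- The dilated function `φ_t(x) = t^{-n} φ(x/t)`. -/
def dil (n : ℕ) (φ : Eucl n → ℝ) (t : ℝ) (x : Eucl n) : ℝ :=
  (t ^ n)⁻¹ * φ (t⁻¹ • x)

/-- The maximal function `f⁺(x) = sup_{t>0} |(f * φ_t)(x)|`, with values in `ℝ≥0∞`. -/
def maxFun (n : ℕ) (φ : Eucl n → ℝ) (f : Eucl n → ℝ) (x : Eucl n) : ℝ≥0∞ :=
  ⨆ (t : ℝ) (_ : 0 < t), ENNReal.ofReal |∫ y, f y * dil n φ t (x - y)|

/-- `‖f‖_{H¹} = ∫ f⁺`. -/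
def H1Norm (n : ℕ) (φ : Eucl n → ℝ) (f : Eucl n → ℝ) : ℝ≥0∞ :=
  ∫⁻ x, maxFun n φ f x

/-- The growth function `θ(x,t) = t / (log(e+|x|) + log(e+t))`, extended to `t ∈ ℝ≥0∞`. -/
def thetaE (n : ℕ) (x : Eucl n) (t : ℝ≥0∞) : ℝ≥0∞ :=
  t / ENNReal.ofReal (Real.log (Real.exp 1 + ‖x‖) + Real.log (Real.exp 1 + t.toReal))

/-- The Luxemburg (quasi-)norm associated to `θ`. -/
def luxNorm (n : ℕ) (g : Eucl n → ℝ≥0∞) : ℝ≥0∞ :=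
  sInf {lam : ℝ≥0∞ | lam ≠ 0 ∧ ∫⁻ x, thetaE n x (g x / lam) ≤ 1}

/-- `‖f‖_{H^{log}} = ‖f⁺‖_{L^θ}`. -/
def HlogNorm (n : ℕ) (φ : Eucl n → ℝ) (f : Eucl n → ℝ) : ℝ≥0∞ :=
  luxNorm n (maxFun n φ f)

/-- Mean of `g` over a set `B`. -/
def setAvg (n : ℕ) (g : Eucl n → ℝ) (B : Set (Eucl n)) : ℝ :=
  (∫ x in B, g x) / (volume B).toReal

/-- The open unit cube `(0,1)ⁿ`. -/
def unitCube (n : ℕ) : Set (Eucl n) := {x | ∀ i, x i ∈ Set.Ioo (0 : ℝ) 1}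

/-- `‖g‖_{BMO⁺} = ∫_{(0,1)ⁿ} |g| + sup_B |B|⁻¹ ∫_B |g - g_B|`. -/
def BMOplus (n : ℕ) (g : Eucl n → ℝ) : ℝ≥0∞ :=
  (∫⁻ x in unitCube n, ENNReal.ofReal |g x|) +
    ⨆ (x₀ : Eucl n) (r : ℝ) (_ : 0 < r),
      (∫⁻ x in ball x₀ r, ENNReal.ofReal |g x - setAvg n g (ball x₀ r)|) / volume (ball x₀ r)

section LogDistance

variable {E : Type*} [NormedAddCommGroup E] [NormedSpace ℝ E] [FiniteDimensional ℝ E]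
  [Nontrivial E] [MeasurableSpace E] [BorelSpace E] (μ : Measure E) [μ.IsAddHaarMeasure]

lemma lintegral_ball_rpow_div_norm_le {ρ : ℝ} (hρ : 0 < ρ) :
    ∫⁻ x in ball (0 : E) ρ, ENNReal.ofReal ((ρ / ‖x‖) ^ (1 / 2 : ℝ)) ∂μ
      ≤ 2 * μ (ball 0 ρ) := by
  set d := Module.finrank ℝ E with hd
  have hd1 : 1 ≤ d := Module.finrank_pos
  have hd1' : (1 : ℝ) ≤ d := by exact_mod_cast hd1
  have key : ∀ y ∈ Set.Ioo 0 ρ, y ^ (d - 1) • (ρ / y) ^ (1 / 2 : ℝ)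
      = ρ ^ (1 / 2 : ℝ) * y ^ ((d : ℝ) - 3 / 2) := by
    intro y hy
    rw [smul_eq_mul, div_rpow hρ.le hy.1.le, ← Real.rpow_natCast, Nat.cast_sub hd1,
      show (d : ℝ) - 3 / 2 = ((d : ℝ) - (1 : ℕ)) - 1 / 2 by push_cast; ring,
      Real.rpow_sub hy.1 _ (1 / 2)]
    ring
  have hint : IntegrableOn (fun y : ℝ => y ^ ((d : ℝ) - 3 / 2)) (Set.Ioo 0 ρ) :=
    ((intervalIntegral.intervalIntegrable_rpow' (by linarith)).1).mono_set Set.Ioo_subset_Ioc_self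
  have hI : IntegrableOn (fun x : E => (ρ / ‖x‖) ^ (1 / 2 : ℝ)) (ball 0 ρ) μ := by
    rw [integrableOn_fun_norm_addHaar μ (f := fun y => (ρ / y) ^ (1 / 2 : ℝ)),
      integrableOn_congr_fun key measurableSet_Ioo]
    exact hint.const_mul _
  have hval : ∫ x in ball (0 : E) ρ, (ρ / ‖x‖) ^ (1 / 2 : ℝ) ∂μ
      = d / (d - 1 / 2) * (ρ ^ d * μ.real (ball 0 1)) := by
    have h1 : ∫ x in ball (0 : E) ρ, (ρ / ‖x‖) ^ (1 / 2 : ℝ) ∂μ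
        = ∫ x : E, (Set.Iio ρ).indicator (fun y => (ρ / y) ^ (1 / 2 : ℝ)) ‖x‖ ∂μ := by
      rw [← integral_indicator measurableSet_ball]
      congr 1 with x
      simp [Set.indicator]
    have h2 : ∫ y in Set.Ioi (0 : ℝ),
        y ^ (d - 1) • (Set.Iio ρ).indicator (fun y => (ρ / y) ^ (1 / 2 : ℝ)) y
        = ∫ y in Set.Ioo 0 ρ, ρ ^ (1 / 2 : ℝ) * y ^ ((d : ℝ) - 3 / 2) := by
      rw [← setIntegral_congr_fun measurableSet_Ioo key, ← Set.Ioi_inter_Iio,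
        ← setIntegral_indicator measurableSet_Iio]
      congr 1 with y
      by_cases hy : y < ρ <;> simp [hy]
    rw [h1, integral_fun_norm_addHaar, ← hd, h2, integral_const_mul, ← integral_Ioc_eq_integral_Ioo,
      ← intervalIntegral.integral_of_le hρ.le, integral_rpow (Or.inl (by linarith)),
      Real.zero_rpow (by linarith), nsmul_eq_mul, smul_eq_mul,
      show (d : ℝ) - 3 / 2 + 1 = d - 1 / 2 by ring, Real.rpow_sub hρ, Real.rpow_natCast]
    have := (Real.rpow_pos_of_pos hρ (1 / 2)).ne'
    have : (d : ℝ) - 1 / 2 ≠ 0 := by linarith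
    field_simp
    simp
  have hball : μ.real (ball (0 : E) ρ) = ρ ^ d * μ.real (ball 0 1) := by
    simp [Measure.real, Measure.addHaar_ball_of_pos μ (0 : E) hρ, hρ.le, hd]
  rw [← ofReal_integral_eq_lintegral_ofReal hI (ae_of_all _ fun x => by positivity), hval, ← hball,
    ENNReal.ofReal_mul (div_nonneg (by linarith) (by linarith)),
    ofReal_measureReal measure_ball_lt_top.ne]
  gcongr
  rw [ENNReal.ofReal_le_iff_le_toReal (by simp), div_le_iff₀ (by linarith)]
  simp
  linarith

lemma lintegral_ball_rpow_div_norm_sub_le (x₀ : E) {ρ : ℝ} (hρ : 0 < ρ) :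
    ∫⁻ x in ball x₀ ρ, ENNReal.ofReal ((ρ / ‖x - x₀‖) ^ (1 / 2 : ℝ)) ∂μ
      ≤ 2 * μ (ball x₀ ρ) := by
  have h := (measurePreserving_sub_right μ x₀).setLIntegral_comp_preimage_emb
    (measurableEmbedding_subRight x₀)
    (fun x => ENNReal.ofReal ((ρ / ‖x‖) ^ (1 / 2 : ℝ))) (ball 0 ρ)
  have hpre : (fun x => x - x₀) ⁻¹' ball 0 ρ = ball x₀ ρ := by
    ext x; simp [dist_eq_norm]
  rw [hpre] at h
  rw [h, Measure.addHaar_ball_center μ x₀]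
  exact lintegral_ball_rpow_div_norm_le μ hρ

lemma abs_log_max_sub_log_max_le {s M r : ℝ} (hs : 0 < s) (hsM : s ≤ M) (hr : 0 < r) :
    |log (max M r) - log (max s r)| ≤ 2 * (M / s) ^ (1 / 2 : ℝ) := by
  have hM : 0 < M := hs.trans_le hsM
  have hsr : 0 < max s r := hs.trans_le (le_max_left _ _)
  have h1 : 1 ≤ M / s := (one_le_div hs).2 hsM
  rw [abs_of_nonneg (sub_nonneg.2 (Real.log_le_log hsr (max_le_max_right r hsM))),
    ← Real.log_div (hM.trans_le (le_max_left _ _)).ne' hsr.ne']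
  calc log (max M r / max s r) ≤ log (M / s) := by
        refine Real.log_le_log (by positivity) ((div_le_iff₀ hsr).2 (max_le ?_ ?_))
        · calc M = M / s * s := by field_simp
            _ ≤ _ := by gcongr; exact le_max_left _ _
        · calc r = 1 * r := (one_mul r).symm
            _ ≤ _ := by gcongr; exact le_max_right _ _
    _ ≤ (M / s) ^ (1 / 2 : ℝ) / (1 / 2) := Real.log_le_rpow_div (by positivity) (by norm_num)
    _ = _ := by ring

/-- The truncated logarithm of the distance to a point has bounded mean oscillation, uniformly in
the point and in the truncation. -/
lemma lintegral_ball_log_max_norm_sub_le (x₀ a : E) {R r : ℝ} (hR : 0 < R) (hr : 0 < r) :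
    ∫⁻ x in ball a R,
        ENNReal.ofReal |log (max (‖a - x₀‖ + R) r) - log (max ‖x - x₀‖ r)| ∂μ
      ≤ ENNReal.ofReal (4 * 3 ^ Module.finrank ℝ E) * μ (ball a R) := by
  have hle : ∀ x ∈ ball a R, ‖x - x₀‖ ≤ ‖a - x₀‖ + R := fun x hx => by
    have h := norm_add_le (x - a) (a - x₀)
    rw [sub_add_sub_cancel] at h
    linarith [mem_ball_iff_norm.1 hx]
  rcases le_total (2 * R) ‖a - x₀‖ with hfar | hnear
  · calc _ ≤ ∫⁻ _ in ball a R, ENNReal.ofReal (4 * 3 ^ Module.finrank ℝ E) ∂μ := by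
          refine setLIntegral_mono' measurableSet_ball fun x hx => ENNReal.ofReal_le_ofReal ?_
          have h := norm_add_le (a - x) (x - x₀)
          rw [sub_add_sub_cancel] at h
          have hs : ‖a - x₀‖ - R ≤ ‖x - x₀‖ := by linarith [mem_ball_iff_norm'.1 hx]
          have hs0 : 0 < ‖x - x₀‖ := by linarith
          refine (abs_log_max_sub_log_max_le hs0 (hle x hx) hr).trans ?_
          have h3 : (‖a - x₀‖ + R) / ‖x - x₀‖ ≤ 3 := by
            rw [div_le_iff₀ hs0]; linarith
          have h4 : ((‖a - x₀‖ + R) / ‖x - x₀‖) ^ (1 / 2 : ℝ) ≤ 3 := by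
            calc _ ≤ (3 : ℝ) ^ (1 / 2 : ℝ) := by gcongr
              _ ≤ (3 : ℝ) ^ (1 : ℝ) :=
                Real.rpow_le_rpow_of_exponent_le (by norm_num) (by norm_num)
              _ = 3 := Real.rpow_one 3
          have h5 : (3 : ℝ) ≤ 3 ^ Module.finrank ℝ E :=
            le_self_pow₀ (by norm_num) Module.finrank_pos.ne'
          linarith
      _ = _ := by simp
  · calc _ ≤ ∫⁻ x in ball a R, 2 * ENNReal.ofReal ((3 * R / ‖x - x₀‖) ^ (1 / 2 : ℝ)) ∂μ := by
          refine lintegral_mono_ae ?_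
          filter_upwards [ae_restrict_mem measurableSet_ball,
            ae_restrict_of_ae (Measure.ae_ne μ x₀)] with x hx hne
          rw [← ENNReal.ofReal_ofNat 2, ← ENNReal.ofReal_mul (by norm_num)]
          refine ENNReal.ofReal_le_ofReal ((abs_log_max_sub_log_max_le
            (norm_pos_iff.2 (sub_ne_zero.2 hne)) (hle x hx) hr).trans ?_)
          gcongr
          linarith
      _ = 2 * ∫⁻ x in ball a R, ENNReal.ofReal ((3 * R / ‖x - x₀‖) ^ (1 / 2 : ℝ)) ∂μ :=
          lintegral_const_mul' _ _ (by simp)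
      _ ≤ 2 * ∫⁻ x in ball x₀ (3 * R),
            ENNReal.ofReal ((3 * R / ‖x - x₀‖) ^ (1 / 2 : ℝ)) ∂μ := by
          gcongr
          refine ball_subset_ball' ?_
          rw [dist_eq_norm]
          linarith
      _ ≤ 2 * (2 * μ (ball x₀ (3 * R))) := by
          gcongr
          exact lintegral_ball_rpow_div_norm_sub_le μ x₀ (by positivity)
      _ = _ := by
          rw [Measure.addHaar_ball_mul_of_pos μ x₀ (by norm_num : (0 : ℝ) < 3),
            Measure.addHaar_ball_center μ a,
            ENNReal.ofReal_mul (by norm_num), ENNReal.ofReal_ofNat, ← mul_assoc, ← mul_assoc]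
          norm_num

end LogDistance

lemma ofReal_abs_setAvg_sub_mul_le {n : ℕ} {g : Eucl n → ℝ} {B : Set (Eucl n)}
    (hB : volume B ≠ ∞) (hg : IntegrableOn g B) (c : ℝ) :
    ENNReal.ofReal |setAvg n g B - c| * volume B
      ≤ ∫⁻ x in B, ENNReal.ofReal |g x - c| := by
  rcases eq_or_ne (volume B) 0 with h0 | h0
  · simp [h0]
  have hpos : 0 < volume.real B := ENNReal.toReal_pos h0 hB
  have hc : IntegrableOn (fun _ => c) B := integrableOn_const hB
  have h1 : setAvg n g B - c = (∫ x in B, (g x - c)) / volume.real B := by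
    rw [integral_sub hg hc, setIntegral_const, smul_eq_mul, setAvg, ← Measure.real]
    field_simp
  rw [h1, abs_div, abs_of_pos hpos, ← ofReal_measureReal hB, ← ENNReal.ofReal_mul (by positivity),
    div_mul_cancel₀ _ hpos.ne', ← Real.norm_eq_abs, ofReal_norm]
  refine (enorm_integral_le_lintegral_enorm _).trans_eq ?_
  simp only [← ofReal_norm, Real.norm_eq_abs]

lemma lintegral_abs_sub_setAvg_le {n : ℕ} {g : Eucl n → ℝ} {B : Set (Eucl n)}
    (hB : volume B ≠ ∞) (hg : IntegrableOn g B) (c : ℝ) :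
    ∫⁻ x in B, ENNReal.ofReal |g x - setAvg n g B|
      ≤ 2 * ∫⁻ x in B, ENNReal.ofReal |g x - c| := by
  calc _ ≤ ∫⁻ x in B, (ENNReal.ofReal |g x - c| + ENNReal.ofReal |setAvg n g B - c|) := by
        gcongr with x
        rw [← ENNReal.ofReal_add (abs_nonneg _) (abs_nonneg _), abs_sub_comm (setAvg n g B)]
        exact ENNReal.ofReal_le_ofReal (abs_sub_le _ _ _)
    _ = (∫⁻ x in B, ENNReal.ofReal |g x - c|) + ENNReal.ofReal |setAvg n g B - c| * volume B := by
        rw [lintegral_add_right _ measurable_const, setLIntegral_const]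
    _ ≤ _ := by
        rw [two_mul]
        gcongr
        exact ofReal_abs_setAvg_sub_mul_le hB hg c

lemma unitCube_subset_ball (n : ℕ) : unitCube n ⊆ ball 0 (√n + 3) := by
  intro x hx
  have h : ‖x‖ ≤ √n := by
    rw [EuclideanSpace.norm_eq]
    refine Real.sqrt_le_sqrt ?_
    calc ∑ i, ‖x i‖ ^ 2 ≤ ∑ _i : Fin n, (1 : ℝ) := by
          gcongr with i
          rw [Real.norm_of_nonneg (hx i).1.le]
          exact pow_le_one₀ (hx i).1.le (hx i).2.le
      _ = n := by simp
  rw [mem_ball_zero_iff]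
  linarith

/-- `log (e + |x₀|)` differs by a bounded amount from the value at scale `√n + 3` of the truncated
logarithm centred at `x₀`. -/
lemma abs_log_exp_one_add_sub_log_le {t r R : ℝ} (ht : 0 ≤ t) (hr : r ≤ 1) (hR : 3 ≤ R) :
    |log (exp 1 + t) - log (max (t + R) r)| ≤ log R := by
  have he1 : 1 ≤ exp 1 := Real.one_le_exp zero_le_one
  have he3 : exp 1 < 3 := Real.exp_one_lt_three
  rw [max_eq_left (by linarith), abs_sub_comm,
    abs_of_nonneg (sub_nonneg.2 (Real.log_le_log (by positivity) (by linarith))), sub_le_iff_le_add,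
    ← Real.log_mul (by positivity) (by positivity)]
  exact Real.log_le_log (by positivity) (by nlinarith)

/-- **Lemma 5.2**: for every ball `B(x₀,r)` with `r ≤ min(1, |x₀|/2)` there is a `BMO⁺`
function, constant on the ball, bounded below on it by `c(log(e+|x₀|) + log(1/r))`,
with uniformly bounded `BMO⁺` norm. -/
theorem exists_BMO_function_adapted_to_small_ball (n : ℕ) :
    ∃ C : ℝ, 0 < C ∧
      ∀ (x₀ : Eucl n) (r : ℝ), 0 < r → r ≤ min 1 (‖x₀‖ / 2) →
        ∃ G : Eucl n → ℝ,
          LocallyIntegrable G volume ∧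
          (∃ c : ℝ, ∀ᵐ x ∂volume, x ∈ ball x₀ r → G x = c) ∧
          (∀ᵐ x ∂volume, x ∈ ball x₀ r →
            C⁻¹ * (Real.log (Real.exp 1 + ‖x₀‖) + Real.log (1 / r)) ≤ G x) ∧
          BMOplus n G ≤ ENNReal.ofReal C := by
  rcases Nat.eq_zero_or_pos n with rfl | hn
  · refine ⟨1, one_pos, fun x₀ r hr hr' => ?_⟩
    have h := hr'.trans (min_le_right _ _)
    rw [Subsingleton.elim x₀ 0, norm_zero, zero_div] at h
    exact absurd hr h.not_gt
  have : NeZero n := ⟨hn.ne'⟩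
  set A : ℝ := 4 * 3 ^ n with hA
  set R : ℝ := √n + 3 with hR
  have hR3 : 3 ≤ R := by linarith [Real.sqrt_nonneg n]
  have hlogR : 0 ≤ log R := Real.log_nonneg (by linarith)
  have hA1 : 1 ≤ A := by
    have := one_le_pow₀ (by norm_num : (1 : ℝ) ≤ 3) (n := n)
    linarith
  set V : ℝ := volume.real (ball (0 : Eucl n) R) with hV
  have hV0 : 0 ≤ V := measureReal_nonneg
  have hC1 : 1 ≤ (A + log R) * V + 2 * A := by nlinarith
  refine ⟨(A + log R) * V + 2 * A, by linarith, fun x₀ r hr hr' => ?_⟩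
  have hr1 : r ≤ 1 := hr'.trans (min_le_left _ _)
  have hmax : ∀ x : Eucl n, max ‖x - x₀‖ r ≠ 0 := fun x => (hr.trans_le (le_max_right _ _)).ne'
  have hcont : Continuous fun x : Eucl n => log (exp 1 + ‖x₀‖) - log (max ‖x - x₀‖ r) :=
    continuous_const.sub (Continuous.log (by fun_prop) hmax)
  have hball : ∀ x ∈ ball x₀ r, log (exp 1 + ‖x₀‖) - log (max ‖x - x₀‖ r)
      = log (exp 1 + ‖x₀‖) + log (1 / r) := fun x hx => by
    rw [max_eq_right (mem_ball_iff_norm.1 hx).le, one_div, Real.log_inv, sub_eq_add_neg]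
  have hosc := fun (a : Eucl n) (ρ : ℝ) (hρ : 0 < ρ) =>
    lintegral_ball_log_max_norm_sub_le volume x₀ a hρ hr
  simp only [finrank_euclideanSpace_fin, ← hA] at hosc
  refine ⟨fun x => log (exp 1 + ‖x₀‖) - log (max ‖x - x₀‖ r), hcont.locallyIntegrable,
    ⟨_, ae_of_all _ hball⟩, ae_of_all _ fun x hx => ?_, ?_⟩
  · refine le_of_le_of_eq ?_ (hball x hx).symm
    refine mul_le_of_le_one_left (add_nonneg (Real.log_nonneg ?_) (Real.log_nonneg ?_))
      (inv_le_one_of_one_le₀ hC1)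
    · linarith [Real.one_le_exp zero_le_one, norm_nonneg x₀]
    · exact (one_le_div hr).2 hr1
  rw [BMOplus, ENNReal.ofReal_add (by positivity) (by positivity)]
  gcongr
  · calc _ ≤ ∫⁻ x in ball (0 : Eucl n) R,
            ENNReal.ofReal |log (exp 1 + ‖x₀‖) - log (max ‖x - x₀‖ r)| :=
          lintegral_mono_set (unitCube_subset_ball n)
      _ ≤ ∫⁻ x in ball (0 : Eucl n) R,
            (ENNReal.ofReal |log (max (‖0 - x₀‖ + R) r) - log (max ‖x - x₀‖ r)|
              + ENNReal.ofReal (log R)) := by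
          gcongr with x
          rw [← ENNReal.ofReal_add (abs_nonneg _) hlogR, zero_sub, norm_neg,
            add_comm _ (log R)]
          exact ENNReal.ofReal_le_ofReal ((abs_sub_le _ _ _).trans
            (add_le_add_left (abs_log_exp_one_add_sub_log_le (norm_nonneg x₀) hr1 hR3) _))
      _ ≤ ENNReal.ofReal A * volume (ball (0 : Eucl n) R)
            + ENNReal.ofReal (log R) * volume (ball (0 : Eucl n) R) := by
          rw [lintegral_add_right _ measurable_const, setLIntegral_const]
          gcongr
          exact hosc 0 R (by linarith)
      _ = _ := by
          rw [← add_mul, ← ENNReal.ofReal_add (by positivity) hlogR,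
            ENNReal.ofReal_mul (by positivity), hV, ofReal_measureReal measure_ball_lt_top.ne]
  · refine iSup_le fun a => iSup_le fun ρ => iSup_le fun hρ => ENNReal.div_le_of_le_mul ?_
    refine (lintegral_abs_sub_setAvg_le measure_ball_lt_top.ne
      ((hcont.continuousOn.integrableOn_compact (isCompact_closedBall a ρ)).mono_set
        ball_subset_closedBall)
      (log (exp 1 + ‖x₀‖) - log (max (‖a - x₀‖ + ρ) r))).trans ?_
    rw [ENNReal.ofReal_mul zero_le_two, ENNReal.ofReal_ofNat, mul_assoc]
    gcongr
    simpa only [sub_sub_sub_cancel_left] using hosc a ρ hρ
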